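/- arXiv:2011.00083 — 2 statements merged into one kernel-verified Lean document; each statement's English description precedes it below -/
import Mathlib

section
/- (Lemma 6, estimation on the identified support.) There is a universal constant C₂ (one may take C₂ = 6400) such that the following holds. Let α ∈ (0,1), ℓ ≥ 1, and let p ∈ Δ_k. Suppose n ≥ C₂·s²/(α² min{2^ℓ, s}). Let T ⊆ [k] be any fixed set with |T| = 2s. Draw X_{n/2+1},...,X_n i.i.d. from p, let h_{n/2+1},...,h_n be independent uniformly random hash functions from [k] to [2^ℓ], set Y_i = h_i(X_i), and for x ∈ [k] let N(x) = #{n/2 < i ≤ n : h_i(x) = Y_i}. Define p̂(x) = ((2^ℓ·N(x)/(n/2)) − 1)/(2^ℓ − 1) for x ∈ T. Then with probability at least 0.95, Σ_{x∈T} |p̂(x) − p(x)| ≤ α/2. -/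
open Real BigOperators Finset
open scoped Classical

noncomputable section

/-- A probability vector on `Fin k`. -/
def probVec {k : ℕ} (p : Fin k → ℝ) : Prop := (∀ x, 0 ≤ p x) ∧ ∑ x, p x = 1

/-- Joint pmf of the samples and the (fully uniform, independent) random hash functions:
`ω i = (X_i, h_i)` with `X_i ~ p` and `h_i` uniform among all functions `[k] → [2^ℓ]`. -/
def hashP {k l mh : ℕ} (p : Fin k → ℝ)
    (ω : Fin mh → Fin k × (Fin k → Fin (2 ^ l))) : ℝ :=
  ∏ i, p (ω i).1 * (((2 : ℝ) ^ l) ^ k)⁻¹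

/-- `N(x)`: the number of (second-half) users `i` with `h_i(x) = Y_i`, where `Y_i = h_i(X_i)`. -/
def Ncount {k l mh : ℕ} (ω : Fin mh → Fin k × (Fin k → Fin (2 ^ l))) (x : Fin k) : ℕ :=
  (Finset.univ.filter fun i => (ω i).2 x = (ω i).2 (ω i).1).card

/-- The product weights `∏ i, w (ω i)` of a normalized weight are normalized. -/
lemma sum_prod_weight_eq_one {A : Type*} [Fintype A] (w : A → ℝ) (hw : ∑ a, w a = 1) (m : ℕ) :
    ∑ ω : Fin m → A, ∏ i, w (ω i) = 1 := by
  have h := Finset.prod_univ_sum (fun _ : Fin m => (Finset.univ : Finset A)) (fun _ a => w a)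
  rw [Fintype.piFinset_univ] at h
  rw [← h, hw]
  simp

/-- The second moment of a sum of i.i.d. centered variables is `m` times that of one of them. -/
lemma sum_prod_weight_mul_sq {A : Type*} [Fintype A] (w f : A → ℝ) (hw : ∑ a, w a = 1)
    (hf : ∑ a, w a * f a = 0) (m : ℕ) :
    ∑ ω : Fin m → A, (∏ i, w (ω i)) * (∑ i, f (ω i)) ^ 2 = m * ∑ a, w a * f a ^ 2 := by
  induction m with
  | zero => simp
  | succ m ih =>
    rw [← (Fin.consEquiv fun _ : Fin (m + 1) => A).sum_comp, Fintype.sum_prod_type]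
    simp only [Fin.consEquiv, Equiv.coe_fn_mk, Fin.prod_univ_succ, Fin.sum_univ_succ,
      Fin.cons_zero, Fin.cons_succ]
    have expand : ∀ (a : A) (ω : Fin m → A),
        w a * (∏ i, w (ω i)) * (f a + ∑ i, f (ω i)) ^ 2 =
          w a * f a ^ 2 * (∏ i, w (ω i)) +
            2 * (w a * f a) * ((∏ i, w (ω i)) * ∑ i, f (ω i)) +
            w a * ((∏ i, w (ω i)) * (∑ i, f (ω i)) ^ 2) := fun a ω => by ring
    simp only [expand, Finset.sum_add_distrib, ← Finset.mul_sum, ← Finset.sum_mul, hw, hf, ih,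
      sum_prod_weight_eq_one w hw]
    push_cast
    ring

/-- Two distinct points collide under a fraction `1 / b` of all functions `Fin k → Fin b`. -/
lemma mul_sum_collision {k b : ℕ} {x y : Fin k} (hxy : x ≠ y) :
    (b : ℝ) * ∑ h : Fin k → Fin b, (if h x = h y then (1 : ℝ) else 0) = (b : ℝ) ^ k := by
  have hfiber : ∀ v : Fin b,
      ∑ h : Fin k → Fin b, (if h x = v ∧ h y = v then (1 : ℝ) else 0) = (b : ℝ) ^ (k - 2) := by
    intro v
    have hset : (Finset.univ.filter fun h : Fin k → Fin b => h x = v ∧ h y = v) =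
        Fintype.piFinset fun j => if j ∈ ({x, y} : Finset (Fin k)) then {v} else Finset.univ := by
      ext h
      simp only [Finset.mem_filter, Finset.mem_univ, true_and, Fintype.mem_piFinset]
      constructor
      · rintro ⟨hx, hy⟩ j
        split_ifs with hj
        · rcases Finset.mem_insert.1 hj with rfl | hj
          · simpa using hx
          · rw [Finset.mem_singleton.1 hj]
            simpa using hy
        · exact Finset.mem_univ _
      · intro hj
        exact ⟨by simpa using hj x, by simpa using hj y⟩
    rw [Finset.sum_boole, hset, Fintype.card_piFinset]
    have hcard : ∀ j : Fin k,
        (if j ∈ ({x, y} : Finset (Fin k)) then {v} else (Finset.univ : Finset (Fin b))).card =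
          if j ∈ ({x, y} : Finset (Fin k)) then 1 else b := by
      intro j
      split_ifs <;> simp
    simp only [hcard]
    rw [Finset.prod_ite, Finset.prod_const_one, one_mul, Finset.prod_const,
      Finset.filter_not, Finset.filter_mem_eq_inter, Finset.univ_inter,
      Finset.card_sdiff_of_subset (Finset.subset_univ _), Finset.card_pair hxy, Finset.card_univ,
      Fintype.card_fin]
    push_cast
    rfl
  have hsplit : ∀ h : Fin k → Fin b, (if h x = h y then (1 : ℝ) else 0) =
      ∑ v, if h x = v ∧ h y = v then (1 : ℝ) else 0 := by
    intro h
    simp only [ite_and, Finset.sum_ite_eq, Finset.mem_univ, if_true]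
    simp only [eq_comm]
  have hk : 2 ≤ k := by
    have := Finset.card_le_univ ({x, y} : Finset (Fin k))
    rwa [Finset.card_pair hxy, Fintype.card_fin] at this
  rw [Finset.sum_congr rfl fun h _ => hsplit h, Finset.sum_comm,
    Finset.sum_congr rfl fun v _ => hfiber v, Finset.sum_const, Finset.card_univ,
    Fintype.card_fin, nsmul_eq_mul]
  obtain ⟨j, rfl⟩ := Nat.exists_eq_add_of_le hk
  rw [Nat.add_sub_cancel_left]
  ring

/-- The weight of a single pair `(X, h)`. -/
def pairWeight {k : ℕ} (l : ℕ) (p : Fin k → ℝ) (a : Fin k × (Fin k → Fin (2 ^ l))) : ℝ :=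
  p a.1 * (((2 : ℝ) ^ l) ^ k)⁻¹

/-- The indicator of `h x = h X` for a pair `(X, h)`. -/
def collision {k l : ℕ} (x : Fin k) (a : Fin k × (Fin k → Fin (2 ^ l))) : ℝ :=
  if a.2 x = a.2 a.1 then 1 else 0

/-- The probability that `h x = h X`. -/
def collisionProb {k : ℕ} (l : ℕ) (p : Fin k → ℝ) (x : Fin k) : ℝ :=
  p x * (1 - ((2 : ℝ) ^ l)⁻¹) + ((2 : ℝ) ^ l)⁻¹

lemma sum_pairWeight {k l : ℕ} {p : Fin k → ℝ} (hp : probVec p) :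
    ∑ a, pairWeight l p a = 1 := by
  have hL : (((2 : ℝ) ^ l) ^ k) ≠ 0 := by positivity
  simp only [pairWeight, Fintype.sum_prod_type, Finset.sum_const, Finset.card_univ,
    Fintype.card_fun, Fintype.card_fin, nsmul_eq_mul]
  rw [← Finset.mul_sum, ← Finset.sum_mul, hp.2]
  push_cast
  field_simp

lemma sum_pairWeight_mul_collision {k l : ℕ} {p : Fin k → ℝ} (hp : probVec p) (x : Fin k) :
    ∑ a, pairWeight l p a * collision x a = collisionProb l p x := by
  have hL : ((2 : ℝ) ^ l) ≠ 0 := by positivity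
  have hX : ∀ X : Fin k, ∑ h : Fin k → Fin (2 ^ l),
      pairWeight l p (X, h) * collision x (X, h) =
        p X * ((2 : ℝ) ^ l)⁻¹ + if x = X then p X * (1 - ((2 : ℝ) ^ l)⁻¹) else 0 := by
    intro X
    simp only [pairWeight, collision]
    rw [← Finset.mul_sum]
    split_ifs with hxX
    · subst hxX
      simp only [if_true, Finset.sum_const, Finset.card_univ, Fintype.card_fun, Fintype.card_fin,
        nsmul_eq_mul]
      push_cast
      field_simp
      ring
    · have h := mul_sum_collision (b := 2 ^ l) hxX
      push_cast at h
      rw [← h]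
      have hS : ∑ h : Fin k → Fin (2 ^ l), (if h x = h X then (1 : ℝ) else 0) ≠ 0 := by
        intro h0
        rw [h0, mul_zero] at h
        exact pow_ne_zero k hL h.symm
      field_simp
      ring
  rw [Fintype.sum_prod_type, Finset.sum_congr rfl fun X _ => hX X, Finset.sum_add_distrib,
    ← Finset.sum_mul, hp.2, Finset.sum_ite_eq, if_pos (Finset.mem_univ x), collisionProb]
  ring

/-- The variance of the collision count is at most its mean. -/
lemma sum_hashP_mul_sq_le {k l : ℕ} {p : Fin k → ℝ} (hp : probVec p) (m : ℕ) (x : Fin k) :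
    ∑ ω : Fin m → Fin k × (Fin k → Fin (2 ^ l)),
      hashP p ω * ((Ncount ω x : ℝ) - m * collisionProb l p x) ^ 2 ≤ m * collisionProb l p x := by
  set b := collisionProb l p x with hb
  have hw := sum_pairWeight (l := l) hp
  have hZ := sum_pairWeight_mul_collision (l := l) hp x
  have hmean : ∑ a, pairWeight l p a * (collision x a - b) = 0 := by
    simp only [mul_sub, Finset.sum_sub_distrib, ← Finset.sum_mul, hw, hZ, ← hb]
    ring
  have hvar : ∑ a, pairWeight l p a * (collision x a - b) ^ 2 = b - b ^ 2 := by
    have hsq : ∀ a : Fin k × (Fin k → Fin (2 ^ l)), pairWeight l p a * (collision x a - b) ^ 2 =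
        pairWeight l p a * collision x a * (1 - 2 * b) + pairWeight l p a * b ^ 2 := by
      intro a
      unfold collision
      split_ifs <;> ring
    simp only [hsq, Finset.sum_add_distrib, ← Finset.sum_mul, hw, hZ, ← hb]
    ring
  have hcount : ∀ ω : Fin m → Fin k × (Fin k → Fin (2 ^ l)),
      (Ncount ω x : ℝ) - m * b = ∑ i, (collision x (ω i) - b) := by
    intro ω
    simp [Ncount, collision, Finset.sum_sub_distrib]
  have hmain := sum_prod_weight_mul_sq (pairWeight l p) (fun a => collision x a - b) hw hmean m
  simp only [hcount]
  change ∑ ω : Fin m → Fin k × (Fin k → Fin (2 ^ l)),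
    (∏ i, pairWeight l p (ω i)) * (∑ i, (collision x (ω i) - b)) ^ 2 ≤ m * b
  rw [hmain, hvar]
  exact mul_le_mul_of_nonneg_left (by nlinarith [sq_nonneg b]) (Nat.cast_nonneg m)

lemma hashP_nonneg {k l m : ℕ} {p : Fin k → ℝ} (hp : probVec p)
    (ω : Fin m → Fin k × (Fin k → Fin (2 ^ l))) : 0 ≤ hashP p ω :=
  Finset.prod_nonneg fun i _ => mul_nonneg (hp.1 _) (by positivity)

lemma sum_hashP {k l : ℕ} {p : Fin k → ℝ} (hp : probVec p) (m : ℕ) :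
    ∑ ω : Fin m → Fin k × (Fin k → Fin (2 ^ l)), hashP p ω = 1 :=
  sum_prod_weight_eq_one (pairWeight l p) (sum_pairWeight hp) m

lemma sum_collisionProb_le {k l : ℕ} {p : Fin k → ℝ} (hp : probVec p) (T : Finset (Fin k)) :
    ∑ x ∈ T, collisionProb l p x ≤ 1 + T.card * ((2 : ℝ) ^ l)⁻¹ := by
  have hT : ∑ x ∈ T, p x ≤ 1 :=
    hp.2 ▸ Finset.sum_le_sum_of_subset_of_nonneg (Finset.subset_univ T) fun x _ _ => hp.1 x
  have hle : ∀ x ∈ T, collisionProb l p x ≤ p x + ((2 : ℝ) ^ l)⁻¹ := by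
    intro x _
    have : 0 ≤ p x * ((2 : ℝ) ^ l)⁻¹ := mul_nonneg (hp.1 x) (by positivity)
    unfold collisionProb
    linarith
  calc ∑ x ∈ T, collisionProb l p x ≤ ∑ x ∈ T, (p x + ((2 : ℝ) ^ l)⁻¹) := Finset.sum_le_sum hle
    _ = ∑ x ∈ T, p x + T.card * ((2 : ℝ) ^ l)⁻¹ := by
      rw [Finset.sum_add_distrib, Finset.sum_const, nsmul_eq_mul]
    _ ≤ _ := by linarith

/-- The squared error of the estimator in terms of the centered collision count. -/
lemma sq_estimator_sub_le {k l m : ℕ} (hl : 1 ≤ l) (hm : 0 < m) (p : Fin k → ℝ) (x : Fin k)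
    (N : ℝ) :
    (((2 : ℝ) ^ l * N / m - 1) / ((2 : ℝ) ^ l - 1) - p x) ^ 2 ≤
      4 / (m : ℝ) ^ 2 * (N - m * collisionProb l p x) ^ 2 := by
  have hL2 : (2 : ℝ) ≤ (2 : ℝ) ^ l := le_self_pow₀ (by norm_num) (by omega)
  have hm' : (0 : ℝ) < m := by exact_mod_cast hm
  unfold collisionProb
  generalize (2 : ℝ) ^ l = L at hL2
  have hL1 : 0 < L - 1 := by linarith
  have heq : (L * N / m - 1) / (L - 1) - p x =
      L / (L - 1) * ((N - m * (p x * (1 - L⁻¹) + L⁻¹)) / m) := by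
    field_simp
    ring
  have hratio : (L / (L - 1)) ^ 2 ≤ 4 := by
    have h2 : L / (L - 1) ≤ 2 := by rw [div_le_iff₀ hL1]; linarith
    have h0 : 0 ≤ L / (L - 1) := by positivity
    nlinarith
  rw [heq, mul_pow, div_pow (N - _), div_mul_eq_mul_div, ← mul_div_assoc]
  gcongr

/-- Second moment bound for the `ℓ₁` error of the estimator on `T`. -/
lemma sum_hashP_mul_sq_error_le {k l m : ℕ} (hl : 1 ≤ l) (hm : 0 < m) {p : Fin k → ℝ}
    (hp : probVec p) (T : Finset (Fin k)) :
    ∑ ω : Fin m → Fin k × (Fin k → Fin (2 ^ l)), hashP p ω *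
      (∑ x ∈ T, |((2 : ℝ) ^ l * (Ncount ω x : ℝ) / m - 1) / ((2 : ℝ) ^ l - 1) - p x|) ^ 2 ≤
      4 * T.card * (1 + T.card * ((2 : ℝ) ^ l)⁻¹) / m := by
  have hm' : (0 : ℝ) < m := by exact_mod_cast hm
  have hpoint : ∀ ω : Fin m → Fin k × (Fin k → Fin (2 ^ l)), hashP p ω *
      (∑ x ∈ T, |((2 : ℝ) ^ l * (Ncount ω x : ℝ) / m - 1) / ((2 : ℝ) ^ l - 1) - p x|) ^ 2 ≤
      ∑ x ∈ T, (T.card * (4 / (m : ℝ) ^ 2)) *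
        (hashP p ω * ((Ncount ω x : ℝ) - m * collisionProb l p x) ^ 2) := by
    intro ω
    have hcs := (sq_sum_le_card_mul_sum_sq (s := T) (f := fun x =>
      |((2 : ℝ) ^ l * (Ncount ω x : ℝ) / m - 1) / ((2 : ℝ) ^ l - 1) - p x|)).trans
      (mul_le_mul_of_nonneg_left (Finset.sum_le_sum fun x _ => (sq_abs _).trans_le
        (sq_estimator_sub_le hl hm p x (Ncount ω x))) (Nat.cast_nonneg _))
    refine (mul_le_mul_of_nonneg_left hcs (hashP_nonneg hp ω)).trans_eq ?_
    rw [Finset.mul_sum, Finset.mul_sum]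
    exact Finset.sum_congr rfl fun x _ => by ring
  refine (Finset.sum_le_sum fun ω _ => hpoint ω).trans ?_
  rw [Finset.sum_comm]
  simp only [← Finset.mul_sum]
  calc (T.card * (4 / (m : ℝ) ^ 2)) * ∑ x ∈ T, ∑ ω : Fin m → Fin k × (Fin k → Fin (2 ^ l)),
        hashP p ω * ((Ncount ω x : ℝ) - m * collisionProb l p x) ^ 2
      ≤ (T.card * (4 / (m : ℝ) ^ 2)) * ∑ x ∈ T, m * collisionProb l p x := by
        gcongr with x _
        exact sum_hashP_mul_sq_le hp m x
    _ = (T.card * (4 / (m : ℝ) ^ 2)) * (m * ∑ x ∈ T, collisionProb l p x) := by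
        rw [← Finset.mul_sum]
    _ ≤ (T.card * (4 / (m : ℝ) ^ 2)) * (m * (1 + T.card * ((2 : ℝ) ^ l)⁻¹)) := by
        gcongr
        exact sum_collisionProb_le hp T
    _ = 4 * T.card * (1 + T.card * ((2 : ℝ) ^ l)⁻¹) / m := by
        field_simp

/-- Chebyshev's inequality for a finite weighted sum. -/
lemma one_sub_le_sum_weight_mul_ite {A : Type*} [Fintype A] (W S : A → ℝ) (hW : ∀ a, 0 ≤ W a)
    (hsum : ∑ a, W a = 1) (hS : ∀ a, 0 ≤ S a) {t : ℝ} (ht : 0 < t) :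
    1 - (∑ a, W a * S a ^ 2) / t ^ 2 ≤ ∑ a, W a * (if S a ≤ t then 1 else 0) := by
  rw [← hsum, Finset.sum_div, ← Finset.sum_sub_distrib]
  refine Finset.sum_le_sum fun a _ => ?_
  rw [mul_div_assoc, ← mul_one_sub]
  refine mul_le_mul_of_nonneg_left ?_ (hW a)
  split_ifs with h
  · have : 0 ≤ S a ^ 2 / t ^ 2 := by positivity
    linarith
  · rw [sub_nonpos, one_le_div (by positivity)]
    have := hS a
    gcongr
    exact (not_le.1 h).le

/-- Lemma 6 (estimation on the identified support): there is a universal constant `C₂`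
such that for any fixed `T` with `|T| = 2s`, if `n ≥ C₂ s²/(α² min{2^ℓ,s})` and
`p̂(x) = ((2^ℓ N(x)/(n/2)) − 1)/(2^ℓ − 1)` is computed from `n/2 = mh` fresh samples and
hashes, then with probability at least `0.95`, `Σ_{x∈T} |p̂(x) − p(x)| ≤ α/2`. -/
theorem lemma6_estimation_on_support :
    ∃ C₂ : ℝ, 0 < C₂ ∧
      ∀ (k s l n mh : ℕ) (α : ℝ) (p : Fin k → ℝ) (T : Finset (Fin k)),
        0 < α → α < 1 → 1 ≤ s → 1 ≤ l → n = 2 * mh → probVec p →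
        T.card = 2 * s →
        C₂ * (s : ℝ) ^ 2 / (α ^ 2 * min ((2 : ℝ) ^ l) (s : ℝ)) ≤ (n : ℝ) →
        (19 : ℝ) / 20 ≤
          ∑ ω : Fin mh → Fin k × (Fin k → Fin (2 ^ l)),
            hashP p ω *
              (if ∑ x ∈ T,
                  |((2 : ℝ) ^ l * (Ncount ω x : ℝ) / ((n : ℝ) / 2) - 1) / ((2 : ℝ) ^ l - 1) -
                    p x| ≤ α / 2
                then 1 else 0) := by
  refine ⟨6400, by norm_num, ?_⟩
  intro k s l n mh α p T hα _ hs hl hn hp hT hbound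
  have hs' : (1 : ℝ) ≤ s := by exact_mod_cast hs
  have hL : (0 : ℝ) < (2 : ℝ) ^ l := by positivity
  have hM : 0 < min ((2 : ℝ) ^ l) (s : ℝ) := lt_min hL (by linarith)
  have hn2 : (n : ℝ) = 2 * mh := by rw [hn]; push_cast; ring
  rw [hn2] at hbound
  have hm' : (0 : ℝ) < mh := by
    have : 0 < 6400 * (s : ℝ) ^ 2 / (α ^ 2 * min ((2 : ℝ) ^ l) (s : ℝ)) := by positivity
    linarith
  have hm : 0 < mh := by exact_mod_cast hm'
  have hhalf : (n : ℝ) / 2 = mh := by rw [hn2]; ring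
  rw [hhalf]
  have hmoment := sum_hashP_mul_sq_error_le hl hm hp T
  rw [hT] at hmoment
  push_cast at hmoment
  refine le_trans ?_ (one_sub_le_sum_weight_mul_ite (hashP p)
    (fun ω => ∑ x ∈ T,
      |((2 : ℝ) ^ l * (Ncount ω x : ℝ) / mh - 1) / ((2 : ℝ) ^ l - 1) - p x|)
    (hashP_nonneg hp) (sum_hashP hp mh)
    (fun ω => Finset.sum_nonneg fun x _ => abs_nonneg _) (half_pos hα))
  rw [le_sub_comm, div_le_iff₀ (by positivity)]
  refine hmoment.trans ?_
  rw [div_le_iff₀ hm']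
  rw [div_le_iff₀ (by positivity)] at hbound
  set M := min ((2 : ℝ) ^ l) (s : ℝ)
  have hfactor : 1 + 2 * (s : ℝ) * ((2 : ℝ) ^ l)⁻¹ ≤ 3 * s / M := by
    have h1 : 1 ≤ (s : ℝ) / M := by
      rw [one_le_div hM]
      exact min_le_right _ _
    have h2 : (s : ℝ) * ((2 : ℝ) ^ l)⁻¹ ≤ s / M := by
      rw [← div_eq_mul_inv]
      exact div_le_div_of_nonneg_left (by linarith) hM (min_le_left _ _)
    rw [mul_div_assoc]
    linarith
  have hsq : 6400 * (s : ℝ) ^ 2 / M ≤ 2 * mh * α ^ 2 := by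
    rw [div_le_iff₀ hM]
    linarith
  calc 4 * (2 * (s : ℝ)) * (1 + 2 * (s : ℝ) * ((2 : ℝ) ^ l)⁻¹)
      ≤ 4 * (2 * (s : ℝ)) * (3 * s / M) := by gcongr
    _ = 24 / 6400 * (6400 * (s : ℝ) ^ 2 / M) := by ring
    _ ≤ 24 / 6400 * (2 * mh * α ^ 2) := by gcongr
    _ ≤ (1 - 19 / 20) * (α / 2) ^ 2 * mh := by
      have : 0 ≤ mh * α ^ 2 := by positivity
      linarith
end
end

section
/- (RAPPOR-based sparse estimation, Appendix C.) Let ε = O(1), α ∈ (0,1), and 1 ≤ s ≤ k/100. Consider the scheme where each of n users holding a sample X_i ~ p ∈ Δ_{k,s} encodes X_i as a one-hot vector in {0,1}^k and flips each bit independently with probability 1/(e^{ε/2}+1) to produce the message Y_i ∈ {0,1}^k; the server uses the first n/2 messages to select the set T of the 2s coordinates with the largest column sums M(x) = Σ_{i≤n/2} Y_i(x), and uses the remaining n/2 messages to estimate p on T. This scheme is ε-LDP, and there is a universal constant C such that for n ≥ C·s² max{log(k/s), 1}/(α² ε²), with probability at least 9/10 the output p̂ satisfies d_TV(p̂, p)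 ≤ α. -/
open Real BigOperators Finset
open scoped Classical

noncomputable section

/-- Support size of a vector. -/
def suppSize {k : ℕ} (p : Fin k → ℝ) : ℕ := (Finset.univ.filter fun x => p x ≠ 0).card

/-- Total variation distance. -/
def dTV {k : ℕ} (p q : Fin k → ℝ) : ℝ := (∑ x, |p x - q x|) / 2

/-- RAPPOR channel: the sample `x` is one-hot encoded in `{0,1}^k` and each bit is flipped
independently with probability `1/(e^{ε/2}+1)`; `rapporQ ε x v` is the probability of
producing the message `v` from input `x`. -/
def rapporQ {k : ℕ} (ε : ℝ) (x : Fin k) (v : Fin k → Bool) : ℝ :=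
  ∏ x', if v x' = decide (x' = x) then
    1 - 1 / (Real.exp (ε / 2) + 1) else 1 / (Real.exp (ε / 2) + 1)

/-- `M(x)`: the column sum `Σ_{i ≤ n/2} Y_i(x)` of the first-half messages. -/
def Mcol {k mh : ℕ} (ω₁ : Fin mh → Fin k → Bool) (x : Fin k) : ℕ :=
  (Finset.univ.filter fun i => ω₁ i x = true).card

section ProductWeights

variable {V : Type*} [Fintype V] {m : ℕ} {w : V → ℝ}

/-- Total mass of a product weight. -/
lemma sum_prod_weight (hw : ∑ v, w v = 1) : ∑ ω : Fin m → V, ∏ i, w (ω i) = 1 := by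
  rw [← Fintype.prod_sum (fun (_ : Fin m) v => w v)]
  simp [hw]

/-- Moment generating function of a sum of independent copies. -/
lemma sum_prod_weight_mul_exp (g : V → ℝ) (l : ℝ) :
    ∑ ω : Fin m → V, (∏ i, w (ω i)) * Real.exp (l * ∑ i, g (ω i)) =
      (∑ v, w v * Real.exp (l * g v)) ^ m := by
  have h : (∑ v, w v * Real.exp (l * g v)) ^ m =
      ∏ _i : Fin m, ∑ v, w v * Real.exp (l * g v) := by simp
  rw [h, Fintype.prod_sum]
  refine Finset.sum_congr rfl fun ω _ => ?_
  rw [Finset.prod_mul_distrib, Finset.mul_sum, Real.exp_sum]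

/-- Distinct coordinates of a product weight are uncorrelated. -/
lemma sum_prod_weight_mul_mul (hw : ∑ v, w v = 1) {g : V → ℝ} (hg : ∑ v, w v * g v = 0)
    (i j : Fin m) :
    ∑ ω : Fin m → V, (∏ l, w (ω l)) * (g (ω i) * g (ω j)) =
      if i = j then ∑ v, w v * g v ^ 2 else 0 := by
  have key : ∀ ω : Fin m → V, (∏ l, w (ω l)) * (g (ω i) * g (ω j)) =
      ∏ l, w (ω l) * ((if l = i then g (ω l) else 1) * (if l = j then g (ω l) else 1)) := by
    intro ω
    rw [Finset.prod_mul_distrib, Finset.prod_mul_distrib]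
    simp
  simp_rw [key]
  rw [← Fintype.prod_sum
    (fun l v => w v * ((if l = i then g v else 1) * (if l = j then g v else 1)))]
  split_ifs with hij
  · subst hij
    rw [Finset.prod_eq_single i]
    · simp [sq]
    · intro l _ hl
      simp [hl, hw]
    · simp
  · refine Finset.prod_eq_zero (Finset.mem_univ i) ?_
    simp [hij, hg]

/-- Second moment of a sum of independent centered variables bounded by one. -/
lemma sum_prod_weight_mul_sq_le (hw0 : ∀ v, 0 ≤ w v) (hw : ∑ v, w v = 1) {g : V → ℝ}
    (hg : ∑ v, w v * g v = 0) (hb : ∀ v, |g v| ≤ 1) :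
    ∑ ω : Fin m → V, (∏ l, w (ω l)) * (∑ i, g (ω i)) ^ 2 ≤ m := by
  have h1 : ∑ ω : Fin m → V, (∏ l, w (ω l)) * (∑ i, g (ω i)) ^ 2 =
      ∑ i : Fin m, ∑ j : Fin m, ∑ ω : Fin m → V, (∏ l, w (ω l)) * (g (ω i) * g (ω j)) := by
    simp_rw [sq, Finset.sum_mul_sum, Finset.mul_sum]
    rw [Finset.sum_comm]
    refine Finset.sum_congr rfl fun i _ => ?_
    rw [Finset.sum_comm]
  have h2 : ∑ v, w v * g v ^ 2 ≤ 1 := by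
    rw [← hw]
    refine Finset.sum_le_sum fun v _ => ?_
    have := (sq_le_one_iff_abs_le_one (g v)).2 (hb v)
    nlinarith [hw0 v]
  rw [h1]
  simp_rw [sum_prod_weight_mul_mul hw hg]
  simp only [Finset.sum_ite_eq, Finset.mem_univ, if_true, Finset.sum_const, Finset.card_univ,
    Fintype.card_fin, nsmul_eq_mul]
  nlinarith [(Nat.cast_nonneg m : (0 : ℝ) ≤ m)]

/-- Exponential moment of a sum of independent centered variables bounded by one. -/
lemma sum_prod_weight_mul_exp_le (hw0 : ∀ v, 0 ≤ w v) (hw : ∑ v, w v = 1) {g : V → ℝ}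
    (hg : ∑ v, w v * g v = 0) (hb : ∀ v, |g v| ≤ 1) {l : ℝ} (hl : |l| ≤ 1) :
    ∑ ω : Fin m → V, (∏ i, w (ω i)) * Real.exp (l * ∑ i, g (ω i)) ≤ Real.exp (m * l ^ 2) := by
  rw [sum_prod_weight_mul_exp, Real.exp_nat_mul]
  refine pow_le_pow_left₀ (Finset.sum_nonneg fun v _ => by have := hw0 v; positivity) ?_ m
  have h : ∑ v, w v * Real.exp (l * g v) ≤ ∑ v, (w v + l * (w v * g v) + w v * l ^ 2) := by
    refine Finset.sum_le_sum fun v _ => ?_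
    have h1 : |l * g v| ≤ 1 := by
      rw [abs_mul]; exact mul_le_one₀ hl (abs_nonneg _) (hb v)
    have h2 := (abs_le.1 (Real.abs_exp_sub_one_sub_id_le h1)).2
    have h3 : (l * g v) ^ 2 ≤ l ^ 2 := by
      have := (sq_le_one_iff_abs_le_one (g v)).2 (hb v)
      nlinarith [sq_nonneg l]
    have h4 : Real.exp (l * g v) ≤ 1 + l * g v + l ^ 2 := by linarith
    nlinarith [mul_le_mul_of_nonneg_left h4 (hw0 v)]
  rw [Finset.sum_add_distrib, Finset.sum_add_distrib, ← Finset.mul_sum, ← Finset.sum_mul, hg,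
    hw] at h
  linarith [Real.add_one_le_exp (l ^ 2)]

end ProductWeights

section Channel

/-- The bit-flip probability of the RAPPOR channel. -/
def flipProb (ε : ℝ) : ℝ := 1 / (Real.exp (ε / 2) + 1)

lemma flipProb_pos (ε : ℝ) : 0 < flipProb ε := by unfold flipProb; positivity

lemma one_sub_flipProb (ε : ℝ) : 1 - flipProb ε = Real.exp (ε / 2) * flipProb ε := by
  unfold flipProb
  have := Real.exp_pos (ε / 2)
  field_simp
  ring

lemma flipProb_lt_one (ε : ℝ) : flipProb ε < 1 := by
  have := one_sub_flipProb ε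
  have := mul_pos (Real.exp_pos (ε / 2)) (flipProb_pos ε)
  linarith

lemma le_one_sub_two_mul_flipProb {ε : ℝ} (h0 : 0 < ε) (h1 : ε ≤ 1) :
    ε / 6 ≤ 1 - 2 * flipProb ε := by
  have hE : ε / 2 + 1 ≤ Real.exp (ε / 2) := Real.add_one_le_exp _
  have h : 1 - 2 * flipProb ε = 1 - 2 / (Real.exp (ε / 2) + 1) := by unfold flipProb; ring
  have h2 : 2 / (Real.exp (ε / 2) + 1) ≤ 2 / (ε / 2 + 1 + 1) := by gcongr
  have h3 : 2 / (ε / 2 + 1 + 1) ≤ 1 - ε / 6 := by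
    rw [div_le_iff₀ (by positivity)]
    nlinarith
  linarith

variable {k : ℕ}

lemma rapporQ_eq (ε : ℝ) (x : Fin k) (v : Fin k → Bool) :
    rapporQ ε x v = ∏ y, if v y = decide (y = x) then 1 - flipProb ε else flipProb ε := rfl

lemma rapporQ_nonneg (ε : ℝ) (x : Fin k) (v : Fin k → Bool) : 0 ≤ rapporQ ε x v := by
  rw [rapporQ_eq]
  refine Finset.prod_nonneg fun y _ => ?_
  have := flipProb_pos ε
  have := flipProb_lt_one ε
  split_ifs <;> linarith

/-- The RAPPOR channel is `ε`-locally differentially private. -/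
lemma rapporQ_le_exp_mul {ε : ℝ} (hε : 0 < ε) (v : Fin k → Bool) (x x' : Fin k) :
    rapporQ ε x v ≤ Real.exp ε * rapporQ ε x' v := by
  set E := Real.exp (ε / 2) with hE
  have hE1 : 1 ≤ E := Real.one_le_exp (by positivity)
  have hq := flipProb_pos ε
  have hq' := one_sub_flipProb ε
  rw [← hE] at hq'
  have hprod : Real.exp ε = ∏ y : Fin k, (if y = x then E else 1) * (if y = x' then E else 1) := by
    rw [Finset.prod_mul_distrib]
    simp [hE, ← Real.exp_add]
  rw [hprod, rapporQ_eq, rapporQ_eq, ← Finset.prod_mul_distrib]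
  have hq1 := flipProb_lt_one ε
  have hqq : flipProb ε ≤ 1 - flipProb ε := by nlinarith
  refine Finset.prod_le_prod (fun y _ => by split_ifs <;> linarith) fun y _ => ?_
  have e1 : 1 - flipProb ε ≤ E * (1 - flipProb ε) := by nlinarith
  have e2 : 1 - flipProb ε ≤ E * E * (1 - flipProb ε) := by nlinarith
  have e3 : flipProb ε ≤ E * flipProb ε := by nlinarith
  have e4 : flipProb ε ≤ E * E * flipProb ε := by nlinarith
  by_cases h1 : y = x <;> by_cases h2 : y = x' <;> cases v y <;> simp [h1, h2] <;>
    first | (subst h1; simp [h2]; linarith) | (subst h2; simp [h1]; linarith)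

/-- The law of a single bit of a RAPPOR message. -/
lemma sum_rapporQ_mul (ε : ℝ) (x y : Fin k) (f : Bool → ℝ) :
    ∑ v : Fin k → Bool, rapporQ ε x v * f (v y) =
      ∑ b, (if b = decide (y = x) then 1 - flipProb ε else flipProb ε) * f b := by
  have key : ∀ v : Fin k → Bool, rapporQ ε x v * f (v y) =
      ∏ z, (if v z = decide (z = x) then 1 - flipProb ε else flipProb ε) *
        (if z = y then f (v z) else 1) := by
    intro v
    rw [Finset.prod_mul_distrib, rapporQ_eq]
    simp
  simp_rw [key]
  rw [← Fintype.prod_sum (fun z b => (if b = decide (z = x) then 1 - flipProb ε else flipProb ε) *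
        (if z = y then f b else 1)), Finset.prod_eq_single y]
  · simp
  · intro z _ hz
    simp only [hz, if_false, mul_one, Fintype.sum_bool]
    by_cases h : z = x <;> simp [h]
  · simp

/-- The law of a single bit of the message of a user whose sample has law `p`. -/
lemma sum_message_mul {p : Fin k → ℝ} (hp : ∑ x, p x = 1) (ε : ℝ) (y : Fin k) (f : Bool → ℝ) :
    ∑ v : Fin k → Bool, (∑ x, p x * rapporQ ε x v) * f (v y) =
      (flipProb ε + (1 - 2 * flipProb ε) * p y) * f true +
        (1 - flipProb ε - (1 - 2 * flipProb ε) * p y) * f false := by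
  simp_rw [Finset.sum_mul]
  rw [Finset.sum_comm]
  simp_rw [mul_assoc, ← Finset.mul_sum, sum_rapporQ_mul]
  have h : ∀ x, p x * ∑ b, (if b = decide (y = x) then 1 - flipProb ε else flipProb ε) * f b =
      p x * (flipProb ε * f true + (1 - flipProb ε) * f false) +
        if y = x then p x * ((1 - 2 * flipProb ε) * (f true - f false)) else 0 := by
    intro x
    by_cases hx : y = x
    · simp [hx]
      ring
    · simp [hx]
  simp_rw [h]
  rw [Finset.sum_add_distrib, ← Finset.sum_mul, hp]
  simp
  ring

end Channel

section Selection

variable {k : ℕ}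

/-- Coordinates left out by a top-`2s` selection lie below any threshold exceeded by at most `s`
coordinates off the support. -/
lemma lt_of_notMem_top {s : ℕ} {T : Finset (Fin k)} {M : Fin k → ℕ} {p : Fin k → ℝ} {τ : ℝ}
    (hT : T.card = 2 * s) (htop : ∀ x ∈ T, ∀ x' ∉ T, M x' ≤ M x) (hs : suppSize p ≤ s)
    (hb : (Finset.univ.filter fun x => p x = 0 ∧ τ ≤ M x).card ≤ s) {x : Fin k} (hx : x ∉ T) :
    (M x : ℝ) < τ := by
  by_contra! h
  have hsub : insert x T ⊆ (Finset.univ.filter fun x => p x ≠ 0) ∪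
      (Finset.univ.filter fun x => p x = 0 ∧ τ ≤ M x) := by
    intro y hy
    have hy' : τ ≤ M y := by
      rcases Finset.mem_insert.1 hy with rfl | hy
      · exact h
      · exact h.trans (by exact_mod_cast htop y hy x hx)
    by_cases hpy : p y = 0 <;> simp [hpy, hy']
  have h1 := (Finset.card_le_card hsub).trans (Finset.card_union_le _ _)
  rw [Finset.card_insert_of_notMem hx] at h1
  unfold suppSize at hs
  omega

/-- Distance of a thresholded estimate from a nonnegative vector. -/
lemma dTV_ite_eq {p : Fin k → ℝ} (hp : ∀ x, 0 ≤ p x) (T : Finset (Fin k)) (h : Fin k → ℝ) :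
    dTV (fun x => if x ∈ T then h x else 0) p =
      (∑ x ∈ T, |h x - p x| + ∑ x ∈ Tᶜ, p x) / 2 := by
  unfold dTV
  rw [← Finset.sum_add_sum_compl T]
  congr 2
  · exact Finset.sum_congr rfl fun x hx => by simp [hx]
  · exact Finset.sum_congr rfl fun x hx => by
      simp [Finset.mem_compl.1 hx, abs_of_nonneg (hp x)]

/-- The mass missed by the selection, when missed coordinates are small up to an error. -/
lemma sum_le_of_forall_le_add {s : ℕ} {p e : Fin k → ℝ} {t : ℝ} (ht : 0 ≤ t)
    (hs : suppSize p ≤ s) (U : Finset (Fin k)) (hU : ∀ x ∈ U, p x ≤ t + |e x|) :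
    ∑ x ∈ U, p x ≤ s * t + ∑ x with p x ≠ 0, |e x| := by
  calc ∑ x ∈ U, p x = ∑ x ∈ U with p x ≠ 0, p x := (Finset.sum_filter_ne_zero U).symm
    _ ≤ ∑ x ∈ U with p x ≠ 0, (t + |e x|) :=
      Finset.sum_le_sum fun x hx => hU x (Finset.mem_filter.1 hx).1
    _ ≤ ∑ x with p x ≠ 0, (t + |e x|) :=
      Finset.sum_le_sum_of_subset_of_nonneg
        (Finset.filter_subset_filter _ (Finset.subset_univ U)) fun x _ _ => by positivity
    _ = (suppSize p : ℝ) * t + ∑ x with p x ≠ 0, |e x| := by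
      rw [Finset.sum_add_distrib, Finset.sum_const, nsmul_eq_mul]; rfl
    _ ≤ s * t + ∑ x with p x ≠ 0, |e x| := by gcongr

/-- An `ℓ¹` bound from a normalized `ℓ²` bound. -/
lemma sum_abs_le_of_sq_le {ι : Type*} {A : Finset ι} {D : ι → ℝ} {r c : ℝ} (hr : 0 ≤ r)
    (hA : (A.card : ℝ) ≤ c) (h : c * ∑ x ∈ A, D x ^ 2 ≤ r ^ 2) : ∑ x ∈ A, |D x| ≤ r := by
  refine abs_le_of_sq_le_sq' ?_ hr |>.2
  calc (∑ x ∈ A, |D x|) ^ 2 ≤ A.card * ∑ x ∈ A, |D x| ^ 2 := sq_sum_le_card_mul_sum_sq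
    _ = A.card * ∑ x ∈ A, D x ^ 2 := by simp_rw [sq_abs]
    _ ≤ c * ∑ x ∈ A, D x ^ 2 := by gcongr
    _ ≤ r ^ 2 := h

end Selection

section Estimation

variable {k m : ℕ}

/-- Debiased empirical frequencies on the selected coordinates, zero elsewhere. -/
def rapporEst (ε : ℝ) (T : Finset (Fin k)) (ω : Fin m → Fin k → Bool) (x : Fin k) : ℝ :=
  if x ∈ T then (Mcol ω x / m - flipProb ε) / (1 - 2 * flipProb ε) else 0

/-- A bit of a message, centered at its mean. -/
def centeredBit (ε : ℝ) (p : Fin k → ℝ) (x : Fin k) (v : Fin k → Bool) : ℝ :=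
  (if v x = true then 1 else 0) - (flipProb ε + (1 - 2 * flipProb ε) * p x)

/-- Deviation of a column sum from its mean. -/
def colDev (ε : ℝ) (p : Fin k → ℝ) (x : Fin k) (ω : Fin m → Fin k → Bool) : ℝ :=
  ∑ i, centeredBit ε p x (ω i)

lemma Mcol_eq_add_colDev (ε : ℝ) (p : Fin k → ℝ) (x : Fin k) (ω : Fin m → Fin k → Bool) :
    (Mcol ω x : ℝ) = m * (flipProb ε + (1 - 2 * flipProb ε) * p x) + colDev ε p x ω := by
  unfold Mcol colDev centeredBit
  rw [Finset.sum_sub_distrib]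
  simp
  ring

lemma abs_centeredBit_le {ε : ℝ} (hδ : 0 ≤ 1 - 2 * flipProb ε) {p : Fin k → ℝ}
    (hp : probVec p) (x : Fin k) (v : Fin k → Bool) : |centeredBit ε p x v| ≤ 1 := by
  have hq := flipProb_pos ε
  have h0 := hp.1 x
  have h1 : p x ≤ 1 := by
    rw [← hp.2]; exact Finset.single_le_sum (fun y _ => hp.1 y) (Finset.mem_univ x)
  unfold centeredBit
  rw [abs_le]
  split_ifs <;> constructor <;> nlinarith

lemma message_nonneg {p : Fin k → ℝ} (hp : ∀ x, 0 ≤ p x) (ε : ℝ) (v : Fin k → Bool) :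
    0 ≤ ∑ x, p x * rapporQ ε x v :=
  Finset.sum_nonneg fun x _ => mul_nonneg (hp x) (rapporQ_nonneg ε x v)

lemma sum_message {p : Fin k → ℝ} (hp : probVec p) (ε : ℝ) :
    ∑ v : Fin k → Bool, ∑ x, p x * rapporQ ε x v = 1 := by
  obtain ⟨y⟩ : Nonempty (Fin k) := by
    by_contra h
    rw [not_nonempty_iff] at h
    simpa using hp.2
  simpa using sum_message_mul hp.2 ε y fun _ => 1

lemma sum_message_mul_centeredBit {p : Fin k → ℝ} (hp : probVec p) (ε : ℝ) (y : Fin k) :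
    ∑ v : Fin k → Bool, (∑ x, p x * rapporQ ε x v) * centeredBit ε p y v = 0 := by
  have h := sum_message_mul hp.2 ε y fun b =>
    (if b = true then 1 else 0) - (flipProb ε + (1 - 2 * flipProb ε) * p y)
  unfold centeredBit
  rw [h]
  simp
  ring

/-- Deterministic guarantee: few spurious large columns and small `ℓ¹` deviations make the
estimate accurate. -/
lemma dTV_rapporEst_le {s : ℕ} {ε α : ℝ} (hs : 0 < s) (hα : 0 < α) (hm : 0 < m)
    (hδ : 0 < 1 - 2 * flipProb ε) {p : Fin k → ℝ} (hp : probVec p) (hsupp : suppSize p ≤ s)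
    {ω₁ ω₂ : Fin m → Fin k → Bool} {T : Finset (Fin k)} (hT : T.card = 2 * s)
    (htop : ∀ x ∈ T, ∀ x' ∉ T, Mcol ω₁ x' ≤ Mcol ω₁ x)
    (hb : (Finset.univ.filter fun x => p x = 0 ∧
      m * (1 - 2 * flipProb ε) * (α / s) ≤ colDev ε p x ω₁).card ≤ s)
    (h₁ : ∑ x with p x ≠ 0, |colDev ε p x ω₁| ≤ m * (1 - 2 * flipProb ε) * α / 2)
    (h₂ : ∑ x ∈ T, |colDev ε p x ω₂| ≤ m * (1 - 2 * flipProb ε) * α / 2) :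
    dTV (rapporEst ε T ω₂) p ≤ α := by
  set δ := 1 - 2 * flipProb ε with hδ_def
  have hm' : (0 : ℝ) < m := by exact_mod_cast hm
  have hs' : (0 : ℝ) < s := by exact_mod_cast hs
  have hN : 0 < m * δ := by positivity
  have hmiss : ∀ x ∈ Tᶜ, p x ≤ α / s + |colDev ε p x ω₁ / (m * δ)| := by
    intro x hx
    have hlt := lt_of_notMem_top (τ := m * (flipProb ε + δ * (α / s))) hT htop hsupp
      ((Finset.card_le_card fun y hy => by
        simp only [Finset.mem_filter, Finset.mem_univ, true_and] at hy ⊢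
        refine ⟨hy.1, ?_⟩
        have := hy.2
        rw [Mcol_eq_add_colDev ε p, hy.1] at this
        linarith).trans hb) (Finset.mem_compl.1 hx)
    rw [Mcol_eq_add_colDev ε p, ← hδ_def] at hlt
    have h : p x ≤ α / s + -(colDev ε p x ω₁ / (m * δ)) := by
      rw [← sub_le_iff_le_add', ← neg_div, le_div_iff₀ hN]
      linarith
    exact h.trans (by gcongr; exact neg_le_abs _)
  have hmass := sum_le_of_forall_le_add (by positivity) hsupp _ hmiss
  have hest : ∀ x, (Mcol ω₂ x / m - flipProb ε) / δ - p x = colDev ε p x ω₂ / (m * δ) := by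
    intro x
    rw [Mcol_eq_add_colDev ε p, ← hδ_def]
    field_simp
    ring
  have hdist := dTV_ite_eq hp.1 T fun x => (Mcol ω₂ x / m - flipProb ε) / δ
  simp only [hest, abs_div, abs_of_pos hN, ← Finset.sum_div] at hdist hmass
  rw [mul_div_cancel₀ _ hs'.ne'] at hmass
  have e₁ := (div_le_iff₀ hN).2 (h₁.trans_eq (by ring : _ = α / 2 * (m * δ)))
  have e₂ := (div_le_iff₀ hN).2 (h₂.trans_eq (by ring : _ = α / 2 * (m * δ)))
  change dTV (fun x => if x ∈ T then (Mcol ω₂ x / m - flipProb ε) / δ else 0) p ≤ α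
  rw [hdist]
  linarith

/-- Pointwise lower bound of the success indicator by moments of the column deviations. -/
lemma one_sub_le_indicator {s : ℕ} {ε α l : ℝ} (hs : 0 < s) (hα : 0 < α) (hm : 0 < m)
    (hδ : 0 < 1 - 2 * flipProb ε) (hl : 0 ≤ l) {p : Fin k → ℝ} (hp : probVec p)
    (hsupp : suppSize p ≤ s) {ω₁ ω₂ : Fin m → Fin k → Bool} {T : Finset (Fin k)}
    (hT : T.card = 2 * s) (htop : ∀ x ∈ T, ∀ x' ∉ T, Mcol ω₁ x' ≤ Mcol ω₁ x) :
    1 - (∑ x, Real.exp (l * colDev ε p x ω₁)) *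
          (Real.exp (-(l * (m * (1 - 2 * flipProb ε) * (α / s)))) / s)
      - (∑ x with p x ≠ 0, colDev ε p x ω₁ ^ 2) *
          (4 * s / (m * (1 - 2 * flipProb ε) * α) ^ 2)
      - (∑ x ∈ T, colDev ε p x ω₂ ^ 2) * (8 * s / (m * (1 - 2 * flipProb ε) * α) ^ 2) ≤
      if dTV (rapporEst ε T ω₂) p ≤ α then 1 else 0 := by
  set δ := 1 - 2 * flipProb ε with hδ_def
  have hm' : (0 : ℝ) < m := by exact_mod_cast hm
  have hs' : (0 : ℝ) < s := by exact_mod_cast hs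
  have hN : 0 < m * δ * α := by positivity
  set U := (∑ x, Real.exp (l * colDev ε p x ω₁)) * (Real.exp (-(l * (m * δ * (α / s)))) / s)
    with hU
  set A := (∑ x with p x ≠ 0, colDev ε p x ω₁ ^ 2) * (4 * s / (m * δ * α) ^ 2) with hA
  set B := (∑ x ∈ T, colDev ε p x ω₂ ^ 2) * (8 * s / (m * δ * α) ^ 2) with hB
  have hU0 : 0 ≤ U := by positivity
  have hA0 : 0 ≤ A := by positivity
  have hB0 : 0 ≤ B := by positivity
  split_ifs with hgood
  · linarith
  by_contra! hcon
  refine hgood (dTV_rapporEst_le hs hα hm hδ hp hsupp hT htop ?_ ?_ ?_)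
  · have hcount : ((Finset.univ.filter fun x => p x = 0 ∧
        m * δ * (α / s) ≤ colDev ε p x ω₁).card : ℝ) ≤ U * s := by
      have : U * s = ∑ x, Real.exp (l * colDev ε p x ω₁ - l * (m * δ * (α / s))) := by
        rw [hU, mul_assoc, div_mul_cancel₀ _ hs'.ne', Finset.sum_mul]
        simp_rw [← Real.exp_add, ← sub_eq_add_neg]
      rw [this, Finset.card_eq_sum_ones, Nat.cast_sum]
      refine (Finset.sum_le_sum fun x hx => ?_).trans
        (Finset.sum_le_sum_of_subset_of_nonneg (Finset.subset_univ _) fun x _ _ => by positivity)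
      have hx' := (Finset.mem_filter.1 hx).2.2
      rw [Nat.cast_one]
      exact Real.one_le_exp (by nlinarith)
    have : U * s ≤ s := by nlinarith
    exact_mod_cast hcount.trans this
  · refine sum_abs_le_of_sq_le (c := s) (by positivity) (by exact_mod_cast hsupp) ?_
    have h : A ≤ 1 := by linarith
    rw [hA, ← mul_div_assoc, div_le_one (by positivity)] at h
    linarith
  · refine sum_abs_le_of_sq_le (c := 2 * s) (by positivity) (by rw [hT]; push_cast; rfl) ?_
    have h : B ≤ 1 := by linarith
    rw [hB, ← mul_div_assoc, div_le_one (by positivity)] at h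
    linarith

/-- Success probability of the scheme in terms of the moments of the column deviations. -/
lemma le_success_prob {s : ℕ} {ε α l : ℝ} (hs : 0 < s) (hα : 0 < α) (hm : 0 < m)
    (hδ : 0 < 1 - 2 * flipProb ε) (hl : 0 ≤ l) (hl1 : l ≤ 1) {p : Fin k → ℝ} (hp : probVec p)
    (hsupp : suppSize p ≤ s) {Tsel : (Fin m → Fin k → Bool) → Finset (Fin k)}
    (hT : ∀ ω₁, (Tsel ω₁).card = 2 * s ∧
      ∀ x ∈ Tsel ω₁, ∀ x' ∉ Tsel ω₁, Mcol ω₁ x' ≤ Mcol ω₁ x) :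
    1 - k / s * Real.exp (m * l ^ 2 - l * (m * (1 - 2 * flipProb ε) * (α / s)))
      - 20 * s ^ 2 / (m * ((1 - 2 * flipProb ε) * α) ^ 2) ≤
      ∑ ω : (Fin m → Fin k → Bool) × (Fin m → Fin k → Bool),
        ((∏ i, ∑ x, p x * rapporQ ε x (ω.1 i)) * (∏ i, ∑ x, p x * rapporQ ε x (ω.2 i))) *
          (if dTV (rapporEst ε (Tsel ω.1) ω.2) p ≤ α then 1 else 0) := by
  have hm' : (0 : ℝ) < m := by exact_mod_cast hm
  have hs' : (0 : ℝ) < s := by exact_mod_cast hs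
  set w : (Fin k → Bool) → ℝ := fun v => ∑ x, p x * rapporQ ε x v
  have hw0 : ∀ v, 0 ≤ w v := message_nonneg hp.1 ε
  have hw1 : ∑ v, w v = 1 := sum_message hp ε
  have hcent : ∀ x, ∑ v, w v * centeredBit ε p x v = 0 := sum_message_mul_centeredBit hp ε
  set P : (Fin m → Fin k → Bool) → ℝ := fun ω => ∏ i, w (ω i)
  have hP0 : ∀ ω, 0 ≤ P ω := fun ω => Finset.prod_nonneg fun i _ => hw0 _
  have hP1 : ∑ ω, P ω = 1 := sum_prod_weight hw1
  have hsq : ∀ x, ∑ ω, P ω * colDev ε p x ω ^ 2 ≤ m := fun x =>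
    sum_prod_weight_mul_sq_le hw0 hw1 (hcent x) (abs_centeredBit_le hδ.le hp x)
  have hexp : ∀ x, ∑ ω, P ω * Real.exp (l * colDev ε p x ω) ≤ Real.exp (m * l ^ 2) := fun x =>
    sum_prod_weight_mul_exp_le hw0 hw1 (hcent x) (abs_centeredBit_le hδ.le hp x)
      (by rwa [abs_of_nonneg hl])
  have hpt := fun ω₁ ω₂ : Fin m → Fin k → Bool =>
    one_sub_le_indicator (ω₂ := ω₂) hs hα hm hδ hl hp hsupp (hT ω₁).1 (hT ω₁).2
  set δ := 1 - 2 * flipProb ε with hδ_def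
  set a := Real.exp (-(l * (m * δ * (α / s)))) / s with ha
  set b := 4 * s / (m * δ * α) ^ 2 with hb
  set c := 8 * s / (m * δ * α) ^ 2 with hc
  have ha0 : 0 ≤ a := by positivity
  have hb0 : 0 ≤ b := by positivity
  have hc0 : 0 ≤ c := by positivity
  have hU : ∑ ω, P ω * ∑ x, Real.exp (l * colDev ε p x ω) ≤ k * Real.exp (m * l ^ 2) := by
    simp_rw [Finset.mul_sum]
    rw [Finset.sum_comm]
    refine (Finset.sum_le_sum fun x _ => hexp x).trans_eq ?_
    simp
  have hset : ∀ S : Finset (Fin k), ∑ ω, P ω * ∑ x ∈ S, colDev ε p x ω ^ 2 ≤ S.card * m := by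
    intro S
    simp_rw [Finset.mul_sum]
    rw [Finset.sum_comm]
    refine (Finset.sum_le_sum fun x _ => hsq x).trans_eq ?_
    simp
  have hA : ∑ ω, P ω * ∑ x with p x ≠ 0, colDev ε p x ω ^ 2 ≤ s * m := by
    refine (hset _).trans ?_
    gcongr
    exact hsupp
  have hB : ∀ ω₁, ∑ ω, P ω * ∑ x ∈ Tsel ω₁, colDev ε p x ω ^ 2 ≤ 2 * s * m := by
    intro ω₁
    refine (hset _).trans_eq ?_
    rw [(hT ω₁).1]
    push_cast
    rfl
  have inner : ∀ ω₁, 1 - (∑ x, Real.exp (l * colDev ε p x ω₁)) * a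
      - (∑ x with p x ≠ 0, colDev ε p x ω₁ ^ 2) * b - 2 * s * m * c ≤
      ∑ ω₂, P ω₂ * (if dTV (rapporEst ε (Tsel ω₁) ω₂) p ≤ α then 1 else 0) := by
    intro ω₁
    refine le_trans ?_
      (Finset.sum_le_sum fun ω₂ _ => mul_le_mul_of_nonneg_left (hpt ω₁ ω₂) (hP0 ω₂))
    simp_rw [mul_sub (P _), ← mul_assoc]
    rw [Finset.sum_sub_distrib, Finset.sum_sub_distrib, Finset.sum_sub_distrib]
    simp only [← Finset.sum_mul, hP1]
    nlinarith [mul_le_mul_of_nonneg_right (hB ω₁) hc0]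
  have outer : 1 - k * Real.exp (m * l ^ 2) * a - s * m * b - 2 * s * m * c ≤
      ∑ ω₁, P ω₁ *
        ∑ ω₂, P ω₂ * (if dTV (rapporEst ε (Tsel ω₁) ω₂) p ≤ α then 1 else 0) := by
    refine le_trans ?_
      (Finset.sum_le_sum fun ω₁ _ => mul_le_mul_of_nonneg_left (inner ω₁) (hP0 ω₁))
    simp_rw [mul_sub (P _), ← mul_assoc (P _)]
    rw [Finset.sum_sub_distrib, Finset.sum_sub_distrib, Finset.sum_sub_distrib]
    simp only [← Finset.sum_mul, hP1]
    nlinarith [mul_le_mul_of_nonneg_right hU ha0, mul_le_mul_of_nonneg_right hA hb0]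
  rw [Fintype.sum_prod_type]
  simp_rw [mul_assoc (∏ _, _), ← Finset.mul_sum]
  refine le_trans (le_of_eq ?_) outer
  have e1 : k / s * Real.exp (m * l ^ 2 - l * (m * δ * (α / s))) =
      k * Real.exp (m * l ^ 2) * a := by
    rw [ha, sub_eq_add_neg, Real.exp_add]
    ring
  have e2 : 20 * s ^ 2 / (m * (δ * α) ^ 2) = s * m * b + 2 * s * m * c := by
    rw [hb, hc]
    field_simp
    ring
  rw [e1, e2]
  ring

end Estimation

/-- RAPPOR-based sparse estimation (Appendix C): the RAPPOR channel is ε-LDP, and there is a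
universal constant `C` such that for `ε = O(1)` (here `ε ≤ 1`), if
`n ≥ C s² max{log(k/s),1}/(α²ε²)` (with `n = 2·mh`), there is an estimator `Est`
(taking the selected set `T` and the second-half messages) such that for every selection rule
`Tsel` picking the `2s` coordinates with the largest column sums `M(x)` of the first-half
messages, and every `p ∈ Δ_{k,s}`, with probability at least `9/10`,
`d_TV(Est (Tsel ω₁) ω₂, p) ≤ α`. -/
theorem rappor_sparse_estimation :
    ∃ C : ℝ, 0 < C ∧
      ∀ (k s n mh : ℕ) (ε α : ℝ),
        0 < ε → ε ≤ 1 → 0 < α → α < 1 → 1 ≤ s → 100 * s ≤ k → n = 2 * mh →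
        C * (s : ℝ) ^ 2 * max (Real.log ((k : ℝ) / (s : ℝ))) 1 / (α ^ 2 * ε ^ 2) ≤ (n : ℝ) →
        (∀ (v : Fin k → Bool) (x x' : Fin k),
          rapporQ ε x v ≤ Real.exp ε * rapporQ ε x' v) ∧
        ∃ Est : Finset (Fin k) → (Fin mh → Fin k → Bool) → Fin k → ℝ,
          ∀ Tsel : (Fin mh → Fin k → Bool) → Finset (Fin k),
            (∀ ω₁, (Tsel ω₁).card = 2 * s ∧
              ∀ x ∈ Tsel ω₁, ∀ x' ∉ Tsel ω₁, Mcol ω₁ x' ≤ Mcol ω₁ x) →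
            ∀ p : Fin k → ℝ, probVec p → suppSize p ≤ s →
              (9 : ℝ) / 10 ≤
                ∑ ω : (Fin mh → Fin k → Bool) × (Fin mh → Fin k → Bool),
                  ((∏ i, ∑ x, p x * rapporQ ε x (ω.1 i)) *
                      (∏ i, ∑ x, p x * rapporQ ε x (ω.2 i))) *
                    (if dTV (Est (Tsel ω.1) ω.2) p ≤ α then 1 else 0) := by
  refine ⟨115200, by norm_num, ?_⟩
  intro k s n mh ε α hε hε1 hα hα1 hs hk hn hC
  refine ⟨rapporQ_le_exp_mul hε, rapporEst ε, ?_⟩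
  intro Tsel hT p hp hsupp
  have hs' : (0 : ℝ) < s := by exact_mod_cast hs
  have hk' : (100 : ℝ) * s ≤ k := by exact_mod_cast hk
  have hk0 : (0 : ℝ) < k := by linarith
  set L := max (Real.log ((k : ℝ) / (s : ℝ))) 1 with hL
  have hL1 : 1 ≤ L := le_max_right _ _
  have hLlog : Real.log ((k : ℝ) / s) ≤ L := le_max_left _ _
  have hδε := le_one_sub_two_mul_flipProb hε hε1
  have hδ1 : 1 - 2 * flipProb ε ≤ 1 := by linarith [flipProb_pos ε]
  have hδ : 0 < 1 - 2 * flipProb ε := by linarith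
  have hm : 0 < mh := by
    rcases Nat.eq_zero_or_pos mh with rfl | h
    · subst hn
      have : 0 < 115200 * (s : ℝ) ^ 2 * L / (α ^ 2 * ε ^ 2) := by positivity
      simp only [mul_zero, Nat.cast_zero] at hC
      linarith
    · exact h
  have hm' : (0 : ℝ) < mh := by exact_mod_cast hm
  have hsample : 1600 * ((s : ℝ) ^ 2 * L) ≤ mh * ((1 - 2 * flipProb ε) * α) ^ 2 := by
    rw [div_le_iff₀ (by positivity), hn] at hC
    push_cast at hC
    have h1 : (ε / 6) ^ 2 ≤ (1 - 2 * flipProb ε) ^ 2 := by gcongr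
    have h2 := mul_le_mul_of_nonneg_left h1 (by positivity : (0 : ℝ) ≤ mh * α ^ 2)
    nlinarith
  have hprob := le_success_prob (l := (1 - 2 * flipProb ε) * (α / s) / 2) hs hα hm hδ
    (by positivity) (by
      have h1 : α / s ≤ 1 := by
        rw [div_le_one hs']
        have : (1 : ℝ) ≤ s := by exact_mod_cast hs
        linarith
      have h2 : 0 < α / s := by positivity
      nlinarith) hp hsupp hT
  refine le_trans ?_ hprob
  set δ := 1 - 2 * flipProb ε
  have hvar : 20 * (s : ℝ) ^ 2 / (mh * (δ * α) ^ 2) ≤ 1 / 80 := by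
    rw [div_le_div_iff₀ (by positivity) (by norm_num)]
    nlinarith [sq_nonneg (s : ℝ)]
  have hexponent : mh * (δ * (α / s) / 2) ^ 2 - δ * (α / s) / 2 * (mh * δ * (α / s)) ≤
      -(2 * Real.log ((k : ℝ) / s)) := by
    have h1 : mh * (δ * (α / s) / 2) ^ 2 - δ * (α / s) / 2 * (mh * δ * (α / s)) =
        -(mh * (δ * α) ^ 2 / s ^ 2 / 4) := by
      field_simp
      ring
    have h2 : 1600 * L ≤ mh * (δ * α) ^ 2 / s ^ 2 := by
      rw [le_div_iff₀ (by positivity)]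
      linarith
    rw [h1]
    linarith
  have htail : (k : ℝ) / s *
      Real.exp (mh * (δ * (α / s) / 2) ^ 2 - δ * (α / s) / 2 * (mh * δ * (α / s))) ≤ 1 / 100 := by
    calc _ ≤ (k : ℝ) / s * Real.exp (-(2 * Real.log ((k : ℝ) / s))) := by gcongr
      _ = s / k := by
        rw [two_mul, Real.exp_neg, Real.exp_add, Real.exp_log (by positivity)]
        field_simp
      _ ≤ 1 / 100 := by
        rw [div_le_div_iff₀ hk0 (by norm_num)]
        linarith
  linarith
end
end
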